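/- Let G be a simple graph on a vertex type V, let p be the indicator probabilities of G, let β be real with 0 < β < 1, let u, v be distinct vertices with G.Reachable u v, and let w be any vertex. Then the set of walks ρ from u to v in the complete graph ⊤ on V that maximize the MLH score among all u–v walks in ⊤ and whose support contains w is equal to the set of walks ρ from u to v all of whose edges are edges of G, with ρ.length = G.dist u v, and whose support contains w. (Corollary: betweenness centrality computed with shortest paths on a discrete graph equals betweenness centrality computed with most probable handicapped paths on its induced probabilistic graph.) -/

import Mathlib

/-- The MLH score of a walk in the complete graph on `V`, with respect to edge
probabilities `p` and transmission parameter `β`. -/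
def mlhScore {V : Type*} (p : V → V → ℝ) (β : ℝ) {u v : V}
    (ρ : (⊤ : SimpleGraph V).Walk u v) : ℝ :=
  (ρ.darts.map (fun d => p d.fst d.snd)).prod * β ^ ρ.length

/-- A walk of the complete graph all of whose edges lie in `G` has score `β ^ length`. -/
theorem mlhScore_of_edges_mem {V : Type*} (G : SimpleGraph V) [DecidableRel G.Adj]
    {p : V → V → ℝ} (hp : ∀ x y, p x y = if G.Adj x y then (1 : ℝ) else 0) (β : ℝ) {u v : V}
    {ρ : (⊤ : SimpleGraph V).Walk u v} (hρ : ∀ e ∈ ρ.edges, e ∈ G.edgeSet) :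
    mlhScore p β ρ = β ^ ρ.length := by
  have hprod : (ρ.darts.map (fun d => p d.fst d.snd)).prod = 1 := by
    refine List.prod_eq_one fun x hx => ?_
    obtain ⟨d, hd, rfl⟩ := List.mem_map.mp hx
    have hadj : G.Adj d.fst d.snd := hρ d.edge (List.mem_map_of_mem hd)
    rw [hp, if_pos hadj]
  rw [mlhScore, hprod, one_mul]

/-- A walk of the complete graph using an edge outside `G` has score zero. -/
theorem mlhScore_eq_zero {V : Type*} (G : SimpleGraph V) [DecidableRel G.Adj]
    {p : V → V → ℝ} (hp : ∀ x y, p x y = if G.Adj x y then (1 : ℝ) else 0) (β : ℝ) {u v : V}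
    {ρ : (⊤ : SimpleGraph V).Walk u v} (hρ : ¬ ∀ e ∈ ρ.edges, e ∈ G.edgeSet) :
    mlhScore p β ρ = 0 := by
  push Not at hρ
  obtain ⟨e, he, hne⟩ := hρ
  obtain ⟨d, hd, rfl⟩ := List.mem_map.mp he
  have hnadj : ¬ G.Adj d.fst d.snd := hne
  have hprod : (ρ.darts.map (fun d => p d.fst d.snd)).prod = 0 :=
    List.prod_eq_zero (List.mem_map.mpr ⟨d, hd, by rw [hp, if_neg hnadj]⟩)
  rw [mlhScore, hprod, zero_mul]

/-- A walk of the complete graph all of whose edges lie in `G` is at least as long as the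
distance in `G`. -/
theorem dist_le_length_of_edges_mem {V : Type*} (G : SimpleGraph V) {u v : V}
    {ρ : (⊤ : SimpleGraph V).Walk u v} (hρ : ∀ e ∈ ρ.edges, e ∈ G.edgeSet) :
    G.dist u v ≤ ρ.length :=
  (SimpleGraph.dist_le (ρ.transfer G hρ)).trans_eq (ρ.length_transfer hρ)

/-- Corollary: for indicator edge probabilities from a discrete graph `G` and
`0 < β < 1`, the set of MLH-score-maximizing `u`–`v` walks passing through `w`
coincides with the set of shortest `u`–`v` walks of `G` passing through `w`;
hence betweenness centrality computed with MLH paths equals betweenness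
centrality computed with shortest paths on `G`. -/
theorem mlh_betweenness_eq_discrete_betweenness {V : Type*} (G : SimpleGraph V)
    [DecidableRel G.Adj] (p : V → V → ℝ)
    (hp : ∀ x y, p x y = if G.Adj x y then (1 : ℝ) else 0)
    (β : ℝ) (hβ0 : 0 < β) (hβ1 : β < 1) (u v : V) (huv : u ≠ v)
    (h : G.Reachable u v) (w : V) :
    {ρ : (⊤ : SimpleGraph V).Walk u v |
        (∀ q : (⊤ : SimpleGraph V).Walk u v, mlhScore p β q ≤ mlhScore p β ρ) ∧
          w ∈ ρ.support} =
      {ρ : (⊤ : SimpleGraph V).Walk u v |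
        (∀ e ∈ ρ.edges, e ∈ G.edgeSet) ∧ ρ.length = G.dist u v ∧
          w ∈ ρ.support} := by
  obtain ⟨σ, hσ⟩ := h.exists_walk_length_eq_dist
  have hle : G ≤ ⊤ := le_top
  have hσtop : ∀ e ∈ σ.edges, e ∈ (⊤ : SimpleGraph V).edgeSet := fun e he =>
    SimpleGraph.edgeSet_mono hle (σ.edges_subset_edgeSet he)
  have hscore : mlhScore p β (σ.transfer ⊤ hσtop) = β ^ G.dist u v := by
    rw [mlhScore_of_edges_mem G hp, σ.length_transfer, hσ]
    rw [σ.edges_transfer]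
    exact fun e he => σ.edges_subset_edgeSet he
  ext ρ
  simp only [Set.mem_ofPred_eq, ← and_assoc]
  refine and_congr_left fun _ => ⟨fun hmax => ?_, fun ⟨hρ, hlen⟩ q => ?_⟩
  · have hge := hmax (σ.transfer ⊤ hσtop)
    rw [hscore] at hge
    have hρ : ∀ e ∈ ρ.edges, e ∈ G.edgeSet := by
      by_contra hρ
      rw [mlhScore_eq_zero G hp β hρ] at hge
      exact (pow_pos hβ0 _).not_ge hge
    rw [mlhScore_of_edges_mem G hp β hρ, pow_le_pow_iff_right_of_lt_one₀ hβ0 hβ1] at hge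
    exact ⟨hρ, hge.antisymm (dist_le_length_of_edges_mem G hρ)⟩
  · rw [mlhScore_of_edges_mem G hp β hρ, hlen]
    by_cases hq : ∀ e ∈ q.edges, e ∈ G.edgeSet
    · rw [mlhScore_of_edges_mem G hp β hq]
      exact pow_le_pow_of_le_one hβ0.le hβ1.le (dist_le_length_of_edges_mem G hq)
    · rw [mlhScore_eq_zero G hp β hq]
      exact (pow_pos hβ0 _).le
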